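/- arXiv:1308.0640 — 2 statements merged into one kernel-verified Lean document; each statement's English description precedes it below -/
import Mathlib

section
/- Let d ≥ 1, let α ∈ (0,2), let c_{d,α} = 2^α Γ((d+α)/2) / (π^{d/2} |Γ(−α/2)|), and define K_α(z) = c_{d,α} Σ_{k∈ℤ^d} |z − 2πk|^{−(d+α)} for z ∉ 2πℤ^d. Then there exists a constant C_{α,d} ≥ 1, depending only on α and d (in particular independent of p and of θ), such that for every integer q ≥ 1, with p = 4q, and every smooth 2πℤ^d-periodic function θ : ℝ^d → ℝ with ∫_{[−π,π]^d} θ = 0, one has (1/2) ∫_{[−π,π]^d} ∫_{[−π,π]^d} (θ(x)^{p−1} − θ(y)^{p−1})(θ(x) − θ(y)) K_α(x−y) dy dx ≥ (1/(2p)) ∫_{[−π,π]^d} ∫_{[−π,π]^d} (θ(x)^{p/2} − θ(y)^{p/2})² K_α(x−y) dy dx + (1/C_{α,d}) (∫_{[−π,π]^d} |θ(x)|^p dx). -/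
open Real MeasureTheory

/-- The normalization constant `c_{d,α} = 2^α Γ((d+α)/2) / (π^{d/2} |Γ(−α/2)|)`. -/
noncomputable def fracLapConstD (d : ℕ) (α : ℝ) : ℝ :=
  2 ^ α * Real.Gamma (((d : ℝ) + α) / 2) / (π ^ ((d : ℝ) / 2) * |Real.Gamma (-(α / 2))|)

/-- The periodic kernel `K_α(z) = c_{d,α} Σ_{k∈ℤ^d} |z − 2πk|^{−(d+α)}`. -/
noncomputable def periodicKernelD (d : ℕ) (α : ℝ) (z : EuclideanSpace ℝ (Fin d)) : ℝ :=
  fracLapConstD d α * ∑' k : Fin d → ℤ,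
    ‖z - (EuclideanSpace.equiv (Fin d) ℝ).symm (fun i => 2 * π * (k i : ℝ))‖ ^ (-((d : ℝ) + α))

/-- The period cell `[−π,π]^d`. -/
def periodCell (d : ℕ) : Set (EuclideanSpace ℝ (Fin d)) :=
  {x | ∀ i, x i ∈ Set.Icc (-π) π}


/-- The lattice vector `2πk`. -/
noncomputable def latVec (d : ℕ) (k : Fin d → ℤ) : EuclideanSpace ℝ (Fin d) :=
  (EuclideanSpace.equiv (Fin d) ℝ).symm (fun i => 2 * π * (k i : ℝ))

lemma latVec_apply (d : ℕ) (k : Fin d → ℤ) (i : Fin d) : latVec d k i = 2 * π * (k i : ℝ) := by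
  simp [latVec]

lemma pointwise_pos (n : ℕ) (hn : 1 ≤ n) (a b : ℝ) (hb : 0 ≤ b) (hab : b ≤ a) :
    (a ^ n - b ^ n) ^ 2 ≤ n * ((a ^ (2 * n - 1) - b ^ (2 * n - 1)) * (a - b)) := by
  obtain ⟨m, rfl⟩ : ∃ m, n = m + 1 := ⟨n - 1, by omega⟩
  have ha : 0 ≤ a := hb.trans hab
  have e : 2 * (m + 1) - 1 = m + (m + 1) := by omega
  rw [e]
  have h0 : b ^ (m + 1) ≤ a ^ (m + 1) := by gcongr
  have h0' : b ^ m ≤ a ^ m := by gcongr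
  have h1 : a ^ (m + 1) - b ^ (m + 1) ≤ (a - b) * ((m + 1 : ℕ) : ℝ) * a ^ m := by
    have := abs_pow_sub_pow_le a b (m + 1)
    rw [abs_of_nonneg (by linarith), abs_of_nonneg (by linarith : 0 ≤ a - b), abs_of_nonneg ha,
      abs_of_nonneg hb, max_eq_left hab] at this
    simpa using this
  have h2 : a ^ m * (a ^ (m + 1) - b ^ (m + 1)) ≤ a ^ (m + (m + 1)) - b ^ (m + (m + 1)) := by
    rw [pow_add a m (m + 1), pow_add b m (m + 1)]
    nlinarith [mul_le_mul_of_nonneg_right h0' (pow_nonneg hb (m + 1))]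
  calc (a ^ (m + 1) - b ^ (m + 1)) ^ 2
      = (a ^ (m + 1) - b ^ (m + 1)) * (a ^ (m + 1) - b ^ (m + 1)) := by ring
    _ ≤ ((a - b) * ((m + 1 : ℕ) : ℝ) * a ^ m) * (a ^ (m + 1) - b ^ (m + 1)) :=
        mul_le_mul_of_nonneg_right h1 (by linarith)
    _ = ((a - b) * ((m + 1 : ℕ) : ℝ)) * (a ^ m * (a ^ (m + 1) - b ^ (m + 1))) := by ring
    _ ≤ ((a - b) * ((m + 1 : ℕ) : ℝ)) * (a ^ (m + (m + 1)) - b ^ (m + (m + 1))) :=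
        mul_le_mul_of_nonneg_left h2 (mul_nonneg (by linarith) (by positivity))
    _ = _ := by ring

lemma pointwise_ineq (q : ℕ) (hq : 1 ≤ q) (a b : ℝ) :
    (a ^ (2 * q) - b ^ (2 * q)) ^ 2 ≤
      (4 * q : ℝ) * ((a ^ (4 * q - 1) - b ^ (4 * q - 1)) * (a - b)) := by
  have ev : Even (2 * q) := even_two_mul q
  have od : Odd (4 * q - 1) := ⟨2 * q - 1, by omega⟩
  have e : 2 * (2 * q) - 1 = 4 * q - 1 := by omega
  have hq' : (1 : ℝ) ≤ q := by exact_mod_cast hq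
  have key : ∀ a b : ℝ, 0 ≤ b → b ≤ a → (a ^ (2 * q) - b ^ (2 * q)) ^ 2 ≤
      (4 * q : ℝ) * ((a ^ (4 * q - 1) - b ^ (4 * q - 1)) * (a - b)) := by
    intro a b hb hab
    have h := pointwise_pos (2 * q) (by omega) a b hb hab
    rw [e] at h
    have h3 : b ^ (4 * q - 1) ≤ a ^ (4 * q - 1) := by gcongr
    have h4 : 0 ≤ (a ^ (4 * q - 1) - b ^ (4 * q - 1)) * (a - b) :=
      mul_nonneg (by linarith) (by linarith)
    push_cast at h
    nlinarith
  have key2 : ∀ a b : ℝ, b ≤ a → (a ^ (2 * q) - b ^ (2 * q)) ^ 2 ≤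
      (4 * q : ℝ) * ((a ^ (4 * q - 1) - b ^ (4 * q - 1)) * (a - b)) := by
    intro a b hab
    rcases le_total 0 b with hb | hb
    · exact key a b hb hab
    rcases le_total 0 a with ha | ha
    · -- opposite signs
      obtain ⟨c, rfl⟩ : ∃ c, b = -c := ⟨-b, by ring⟩
      have hc : 0 ≤ c := by linarith
      rw [ev.neg_pow, od.neg_pow]
      have e2 : 4 * q - 1 = (2 * q - 1) + 2 * q := by omega
      have e3 : 2 * q = (2 * q - 1) + 1 := by omega
      have x1 : a ^ (2 * q) * a ^ (2 * q) = a ^ (4 * q - 1) * a := by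
        rw [← pow_add, ← pow_succ]; congr 1; omega
      have x2 : c ^ (2 * q) * c ^ (2 * q) = c ^ (4 * q - 1) * c := by
        rw [← pow_add, ← pow_succ]; congr 1; omega
      have p1 : 0 ≤ a ^ (4 * q - 1) := by positivity
      have p2 : 0 ≤ c ^ (4 * q - 1) := by positivity
      have p3 : 0 ≤ a ^ (2 * q) * c ^ (2 * q) := by positivity
      have h4 : 0 ≤ (a ^ (4 * q - 1) - -c ^ (4 * q - 1)) * (a - -c) :=
        mul_nonneg (by linarith) (by linarith)
      have h5 : (a ^ (2 * q) - c ^ (2 * q)) ^ 2 ≤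
          (a ^ (4 * q - 1) - -c ^ (4 * q - 1)) * (a - -c) := by
        nlinarith [mul_nonneg p1 hc, mul_nonneg p2 ha]
      nlinarith
    · have := key (-b) (-a) (by linarith) (by linarith)
      rw [ev.neg_pow, ev.neg_pow, od.neg_pow, od.neg_pow] at this
      nlinarith
  rcases le_total b a with h | h
  · exact key2 a b h
  · have := key2 b a h
    nlinarith

lemma fracLapConstD_pos (d : ℕ) (α : ℝ) (hα : α ∈ Set.Ioo (0 : ℝ) 2) :
    0 < fracLapConstD d α := by
  obtain ⟨h0, h2⟩ := hα
  have hG : Real.Gamma (-(α / 2)) ≠ 0 := by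
    apply Real.Gamma_ne_zero
    intro m hm
    have hm' : α / 2 = m := by linarith
    have h1 : (0 : ℝ) < m := by linarith
    have h3 : (m : ℝ) < 1 := by linarith
    have h4 : 0 < m := by exact_mod_cast h1
    have h5 : m < 1 := by exact_mod_cast h3
    omega
  have : 0 < Real.Gamma (((d : ℝ) + α) / 2) := Real.Gamma_pos_of_pos (by positivity)
  unfold fracLapConstD
  have := abs_pos.2 hG
  positivity

lemma summable_kernel (d : ℕ) (α : ℝ) (h0 : 0 < α) (z : EuclideanSpace ℝ (Fin d)) :
    Summable (fun k : Fin d → ℤ => ‖z - latVec d k‖ ^ (-((d : ℝ) + α))) := by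
  set b := (EuclideanSpace.basisFun (Fin d) ℝ).toBasis with hb
  set L : Submodule ℤ (EuclideanSpace ℝ (Fin d)) := Submodule.span ℤ (Set.range b) with hL
  have hrank : Module.finrank ℤ L = d := by
    rw [ZLattice.rank ℝ L]; simp
  have hs := ZLattice.summable_norm_sub_rpow L (-((d : ℝ) + α)) (by rw [hrank]; linarith)
    ((2 * π)⁻¹ • z)
  have hmem : ∀ k : Fin d → ℤ, (∑ i, k i • b i) ∈ L := fun k =>
    Submodule.sum_mem _ fun i _ => Submodule.smul_mem _ _ (Submodule.subset_span ⟨i, rfl⟩)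
  have hval : ∀ (k : Fin d → ℤ), latVec d k = (2 * π) • (∑ i, k i • b i) := by
    intro k
    ext j
    simp [latVec_apply, hb, Pi.single_apply]
  let f : (Fin d → ℤ) → L := fun k => ⟨∑ i, k i • b i, hmem k⟩
  have hf : Function.Injective f := by
    intro k l hkl
    have h1 : (∑ i, k i • b i) = ∑ i, l i • b i := congrArg Subtype.val hkl
    have h2 : latVec d k = latVec d l := by rw [hval, hval, h1]
    funext i
    have h3 := congrArg (fun v : EuclideanSpace ℝ (Fin d) => v i) h2
    simp only [latVec_apply] at h3
    have : (k i : ℝ) = l i := mul_left_cancel₀ (by positivity) h3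
    exact_mod_cast this
  have hs2 := (hs.comp_injective hf).mul_left ((2 * π) ^ (-((d : ℝ) + α)))
  refine hs2.congr fun k => ?_
  simp only [Function.comp, f]
  rw [← Real.mul_rpow (by positivity) (by positivity)]
  congr 1
  rw [← abs_of_pos (show 0 < 2 * π by positivity), ← Real.norm_eq_abs, ← norm_smul, smul_sub,
    Real.norm_eq_abs, abs_of_pos (show 0 < 2 * π by positivity), ← hval, smul_smul,
    mul_inv_cancel₀ (by positivity), one_smul, norm_sub_rev]

lemma periodCell_eq (d : ℕ) : periodCell d =
    (WithLp.ofLp : EuclideanSpace ℝ (Fin d) → (Fin d → ℝ)) ⁻¹'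
      (Set.univ.pi fun _ => Set.Icc (-π) π) := by
  ext x
  simp only [periodCell, Set.mem_ofPred_eq, Set.mem_preimage, Set.mem_pi, Set.mem_univ, true_imp_iff]

lemma isCompact_periodCell (d : ℕ) : IsCompact (periodCell d) := by
  rw [periodCell_eq]
  exact (EuclideanSpace.equiv (Fin d) ℝ).toHomeomorph.isCompact_preimage.2
    (isCompact_univ_pi fun _ => isCompact_Icc)

lemma volume_periodCell (d : ℕ) : volume (periodCell d) = ENNReal.ofReal (2 * π) ^ d := by
  rw [periodCell_eq, (PiLp.volume_preserving_ofLp (Fin d)).measure_preimage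
    (MeasurableSet.univ_pi fun _ => measurableSet_Icc).nullMeasurableSet, volume_pi_pi]
  simp [two_mul]

lemma volume_coord_eq (d : ℕ) (i : Fin d) (c : ℝ) :
    volume {x : EuclideanSpace ℝ (Fin d) | x i = c} = 0 := by
  have h := (PiLp.volume_preserving_ofLp (Fin d)).measure_preimage (s := {f | f i = c})
    (measurableSet_eq_fun (measurable_pi_apply i) measurable_const).nullMeasurableSet
  rw [volume_pi, Measure.pi_hyperplane] at h
  exact h

lemma unfold_le (d : ℕ) (G : EuclideanSpace ℝ (Fin d) → ENNReal) (hG : Measurable G)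
    (x : EuclideanSpace ℝ (Fin d)) :
    ∫⁻ y in periodCell d, ∑' k : Fin d → ℤ, G (x - y - latVec d k) ≤ ∫⁻ z, G z := by
  have hm : MeasurableSet (periodCell d) := (isCompact_periodCell d).measurableSet
  rw [lintegral_tsum (fun k => by fun_prop)]
  let s : (Fin d → ℤ) → Set (EuclideanSpace ℝ (Fin d)) :=
    fun k => (fun z => z - latVec d k) ⁻¹' periodCell d
  have hs : ∀ k, MeasurableSet (s k) := fun k => hm.preimage (by fun_prop)
  have hd : Pairwise (Function.onFun (AEDisjoint volume) s) := by
    intro k l hkl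
    obtain ⟨i, hi⟩ := Function.ne_iff.1 hkl
    have hsub : s k ∩ s l ⊆
        {z | z i = 2 * π * k i + π} ∪ {z | z i = 2 * π * k i - π} := by
      rintro z ⟨h1, h2⟩
      have h1 := h1 i
      have h2 := h2 i
      simp only [PiLp.sub_apply, latVec_apply, Set.mem_Icc] at h1 h2
      rcases lt_or_gt_of_ne hi with h | h
      · have h' : (k i : ℝ) + 1 ≤ l i := by exact_mod_cast h
        left
        have := mul_le_mul_of_nonneg_left h' (show 0 ≤ 2 * π by positivity)
        show z i = _
        linarith
      · have h' : (l i : ℝ) + 1 ≤ k i := by exact_mod_cast h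
        right
        have := mul_le_mul_of_nonneg_left h' (show 0 ≤ 2 * π by positivity)
        show z i = _
        linarith
    exact measure_mono_null hsub
      (measure_union_null (volume_coord_eq d i _) (volume_coord_eq d i _))
  have h1 : ∀ k, ∫⁻ y in periodCell d, G (x - y - latVec d k) = ∫⁻ w in s k, G (x - w) := by
    intro k
    rw [← lintegral_indicator hm, ← lintegral_indicator (hs k),
      ← lintegral_sub_right_eq_self _ (latVec d k)]
    congr 1
    funext w
    have e : x - (w - latVec d k) - latVec d k = x - w := by abel
    simp only [Set.indicator, s, e]
    rfl
  simp_rw [h1]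
  rw [← lintegral_iUnion₀ (fun k => (hs k).nullMeasurableSet) hd]
  refine (setLIntegral_le_lintegral _ _).trans ?_
  rw [lintegral_sub_left_eq_self G x]

lemma integrable_trunc (d : ℕ) (hd : 1 ≤ d) (α : ℝ) (hα : α ∈ Set.Ioo (0 : ℝ) 2) :
    Integrable (fun z : EuclideanSpace ℝ (Fin d) =>
      min 1 (‖z‖ ^ 2) * ‖z‖ ^ (-((d : ℝ) + α))) := by
  obtain ⟨h0, h2⟩ := hα
  have : Nonempty (Fin d) := ⟨⟨0, hd⟩⟩
  have hmain := (integrable_fun_norm_addHaar (volume : Measure (EuclideanSpace ℝ (Fin d)))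
    (f := fun r : ℝ => min 1 (r ^ 2) * r ^ (-((d : ℝ) + α)))).2
  refine hmain ?_
  have hfr : Module.finrank ℝ (EuclideanSpace ℝ (Fin d)) = d := by simp
  rw [hfr]
  have hpow : ∀ y : ℝ, 0 < y → y ^ (d - 1) = y ^ ((d : ℝ) - 1) := by
    intro y hy
    rw [← Real.rpow_natCast, Nat.cast_sub hd, Nat.cast_one]
  rw [← Set.Ioc_union_Ioi_eq_Ioi (zero_le_one' ℝ)]
  refine IntegrableOn.union ?_ ?_
  · have h : IntegrableOn (fun y : ℝ => y ^ (1 - α)) (Set.Ioc 0 1) := by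
      have := intervalIntegral.intervalIntegrable_rpow' (a := 0) (b := 1)
        (show -1 < 1 - α by linarith)
      exact (intervalIntegrable_iff_integrableOn_Ioc_of_le zero_le_one).1 this
    refine h.congr_fun (fun y hy => ?_) measurableSet_Ioc
    have hy0 : 0 < y := hy.1
    simp only [smul_eq_mul]
    rw [min_eq_right (by have := hy.2; nlinarith), hpow y hy0, ← Real.rpow_natCast y 2,
      ← Real.rpow_add hy0, ← Real.rpow_add hy0]
    congr 1; push_cast; ring
  · have h : IntegrableOn (fun y : ℝ => y ^ (-1 - α)) (Set.Ioi 1) :=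
      integrableOn_Ioi_rpow_of_lt (by linarith) one_pos
    refine h.congr_fun (fun y hy => ?_) measurableSet_Ioi
    have hy1 : 1 < y := hy
    have hy0 : 0 < y := by linarith
    simp only [smul_eq_mul]
    rw [min_eq_left (by nlinarith), hpow y hy0, one_mul, ← Real.rpow_add hy0]
    congr 1; ring

lemma kernel_toReal (d : ℕ) (α : ℝ) (z : EuclideanSpace ℝ (Fin d)) :
    periodicKernelD d α z = fracLapConstD d α *
      (∑' k : Fin d → ℤ, ENNReal.ofReal (‖z - latVec d k‖ ^ (-((d : ℝ) + α)))).toReal := by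
  rw [ENNReal.tsum_toReal_eq (fun _ => ENNReal.ofReal_ne_top)]
  unfold periodicKernelD
  congr 1
  refine tsum_congr fun k => ?_
  rw [ENNReal.toReal_ofReal (by positivity)]
  rfl

lemma measurable_kernel (d : ℕ) (α : ℝ) : Measurable (periodicKernelD d α) := by
  have : periodicKernelD d α = fun z => fracLapConstD d α *
      (∑' k : Fin d → ℤ, ENNReal.ofReal (‖z - latVec d k‖ ^ (-((d : ℝ) + α)))).toReal :=
    funext (kernel_toReal d α)
  rw [this]
  refine Measurable.const_mul (Measurable.ennreal_toReal (Measurable.tsum fun k => ?_)) _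
  fun_prop

lemma kernel_nonneg (d : ℕ) (α : ℝ) (hα : α ∈ Set.Ioo (0 : ℝ) 2)
    (z : EuclideanSpace ℝ (Fin d)) : 0 ≤ periodicKernelD d α z := by
  rw [kernel_toReal]
  exact mul_nonneg (fracLapConstD_pos d α hα).le ENNReal.toReal_nonneg

lemma kernel_lower (d : ℕ) (α : ℝ) (hα : α ∈ Set.Ioo (0 : ℝ) 2)
    (z : EuclideanSpace ℝ (Fin d)) (hz : z ≠ 0) (R : ℝ) (hR : ‖z‖ ≤ R) :
    fracLapConstD d α * R ^ (-((d : ℝ) + α)) ≤ periodicKernelD d α z := by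
  have hz' : 0 < ‖z‖ := norm_pos_iff.2 hz
  have h0 := hα.1
  unfold periodicKernelD
  refine mul_le_mul_of_nonneg_left ?_ (fracLapConstD_pos d α hα).le
  have h1 : R ^ (-((d : ℝ) + α)) ≤ ‖z‖ ^ (-((d : ℝ) + α)) :=
    Real.rpow_le_rpow_of_nonpos hz' hR (by have : (0 : ℝ) ≤ d := by positivity
                                           linarith)
  refine h1.trans ?_
  have h2 := (summable_kernel d α hα.1 z).le_tsum 0 (fun k _ => by positivity)
  have h3 : latVec d 0 = 0 := by ext i; simp [latVec_apply]
  rw [h3, sub_zero] at h2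
  exact h2

lemma integrable_mul_kernel (d : ℕ) (hd : 1 ≤ d) (α : ℝ) (hα : α ∈ Set.Ioo (0 : ℝ) 2)
    (H : EuclideanSpace ℝ (Fin d) × EuclideanSpace ℝ (Fin d) → ℝ) (hH : Measurable H)
    (C : ℝ) (hC : 0 ≤ C)
    (hb : ∀ x ∈ periodCell d, ∀ y ∈ periodCell d, ∀ k : Fin d → ℤ,
      |H (x, y)| ≤ C * min 1 (‖x - y - latVec d k‖ ^ 2)) :
    Integrable (fun p => H p * periodicKernelD d α (p.1 - p.2))
      ((volume.restrict (periodCell d)).prod (volume.restrict (periodCell d))) := by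
  have hm : MeasurableSet (periodCell d) := (isCompact_periodCell d).measurableSet
  have hmeas : Measurable (fun p : EuclideanSpace ℝ (Fin d) × EuclideanSpace ℝ (Fin d) =>
      H p * periodicKernelD d α (p.1 - p.2)) :=
    hH.mul ((measurable_kernel d α).comp (measurable_fst.sub measurable_snd))
  refine ⟨hmeas.aestronglyMeasurable, ?_⟩
  have hc := fracLapConstD_pos d α hα
  let g : EuclideanSpace ℝ (Fin d) → ℝ := fun z =>
    (C * fracLapConstD d α) * (min 1 (‖z‖ ^ 2) * ‖z‖ ^ (-((d : ℝ) + α)))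
  have hg : Integrable g := (integrable_trunc d hd α hα).const_mul _
  have hgm : Measurable g := by fun_prop
  have hg0 : ∀ z, 0 ≤ g z := fun z => by positivity
  have hfin : ∫⁻ z, ENNReal.ofReal (g z) < ⊤ := by
    have := hg.2
    rw [hasFiniteIntegral_iff_ofReal (Filter.Eventually.of_forall hg0)] at this
    exact this
  have hpt : ∀ x ∈ periodCell d, ∀ y ∈ periodCell d,
      ‖H (x, y) * periodicKernelD d α (x - y)‖ₑ ≤
        ∑' k : Fin d → ℤ, ENNReal.ofReal (g (x - y - latVec d k)) := by
    intro x hx y hy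
    have hsum := summable_kernel d α hα.1 (x - y)
    rw [Real.enorm_eq_ofReal_abs, abs_mul, abs_of_nonneg (kernel_nonneg d α hα _)]
    have e1 : |H (x, y)| * periodicKernelD d α (x - y) =
        ∑' k : Fin d → ℤ, |H (x, y)| * (fracLapConstD d α *
          ‖x - y - latVec d k‖ ^ (-((d : ℝ) + α))) := by
      rw [tsum_mul_left, tsum_mul_left]; rfl
    rw [e1, ENNReal.ofReal_tsum_of_nonneg (fun k => by positivity)
      ((hsum.mul_left _).mul_left _)]
    refine ENNReal.tsum_le_tsum fun k => ENNReal.ofReal_le_ofReal ?_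
    have := mul_le_mul_of_nonneg_right (hb x hx y hy k)
      (show 0 ≤ fracLapConstD d α * ‖x - y - latVec d k‖ ^ (-((d : ℝ) + α)) by positivity)
    refine this.trans (le_of_eq ?_)
    simp only [g]; ring
  rw [HasFiniteIntegral, lintegral_prod _ hmeas.enorm.aemeasurable]
  calc ∫⁻ x in periodCell d, ∫⁻ y in periodCell d,
        ‖H (x, y) * periodicKernelD d α (x - y)‖ₑ
      ≤ ∫⁻ x in periodCell d, ∫⁻ z, ENNReal.ofReal (g z) := by
        refine setLIntegral_mono' hm fun x hx => ?_
        refine (setLIntegral_mono' hm fun y hy => hpt x hx y hy).trans ?_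
        exact unfold_le d (fun z => ENNReal.ofReal (g z)) (by fun_prop) x
    _ = (∫⁻ z, ENNReal.ofReal (g z)) * volume (periodCell d) := by simp
    _ < ⊤ := ENNReal.mul_lt_top hfin (isCompact_periodCell d).measure_lt_top

lemma theta_bound (d : ℕ) (θ : EuclideanSpace ℝ (Fin d) → ℝ) (hθ : ContDiff ℝ (⊤ : ℕ∞) θ)
    (hper : ∀ (x : EuclideanSpace ℝ (Fin d)) (k : Fin d → ℤ), θ (x + latVec d k) = θ x) :
    ∃ M C : ℝ, 0 ≤ M ∧ 0 ≤ C ∧ (∀ x ∈ periodCell d, |θ x| ≤ M) ∧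
      ∀ x ∈ periodCell d, ∀ y ∈ periodCell d, ∀ k : Fin d → ℤ,
        (θ x - θ y) ^ 2 ≤ C * min 1 (‖x - y - latVec d k‖ ^ 2) := by
  obtain ⟨R, hR⟩ := (isCompact_periodCell d).isBounded.subset_closedBall 0
  have hB : IsCompact (Metric.closedBall (0 : EuclideanSpace ℝ (Fin d)) (R + 1)) :=
    isCompact_closedBall _ _
  obtain ⟨M, hM⟩ := (isCompact_periodCell d).exists_bound_of_continuousOn
    hθ.continuous.continuousOn
  have hfd : Continuous (fderiv ℝ θ) := hθ.continuous_fderiv (by simp)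
  obtain ⟨D, hD⟩ := hB.exists_bound_of_continuousOn hfd.continuousOn
  have hlip : ∀ x ∈ Metric.closedBall (0 : EuclideanSpace ℝ (Fin d)) (R + 1),
      ∀ y ∈ Metric.closedBall (0 : EuclideanSpace ℝ (Fin d)) (R + 1),
      ‖θ y - θ x‖ ≤ D * ‖y - x‖ := fun x hx y hy =>
    (convex_closedBall _ _).norm_image_sub_le_of_norm_fderiv_le
      (fun z _ => (hθ.differentiable (by simp)) z) hD hx hy
  refine ⟨max M 0, (2 * M) ^ 2 + D ^ 2, le_max_right _ _, by positivity,
    fun x hx => (hM x hx).trans (le_max_left _ _), ?_⟩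
  intro x hx y hy k
  have hxM := hM x hx
  have hyM := hM y hy
  rw [Real.norm_eq_abs] at hxM hyM
  rcases le_or_gt 1 ‖x - y - latVec d k‖ with h | h
  · rw [min_eq_left (by nlinarith)]
    have h1 : |θ x - θ y| ≤ 2 * M := (abs_sub _ _).trans (by linarith)
    have h2 : (θ x - θ y) ^ 2 ≤ (2 * M) ^ 2 := sq_le_sq' (by linarith [(abs_le.1 h1).1])
      (abs_le.1 h1).2
    nlinarith [sq_nonneg D]
  · rw [min_eq_right (by nlinarith [norm_nonneg (x - y - latVec d k)])]
    have hxR : ‖x‖ ≤ R := by simpa using hR hx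
    have hyR : ‖y + latVec d k‖ ≤ R + 1 := by
      have e : y + latVec d k = x - (x - y - latVec d k) := by abel
      rw [e]
      exact (norm_sub_le _ _).trans (by linarith)
    have h1 := hlip (y + latVec d k) (by simpa using hyR) x (by simp; linarith)
    rw [hper, Real.norm_eq_abs, ← sub_sub] at h1
    have h2 : (θ x - θ y) ^ 2 ≤ (D * ‖x - y - latVec d k‖) ^ 2 :=
      sq_le_sq' (by linarith [(abs_le.1 h1).1]) (abs_le.1 h1).2
    nlinarith [mul_nonneg (sq_nonneg (2 * M)) (sq_nonneg ‖x - y - latVec d k‖)]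

/-- The double integral of the numerators on a finite measure space. -/
lemma double_integral_lower {X : Type*} [MeasurableSpace X] (μ : Measure X) [IsFiniteMeasure μ]
    (θ : X → ℝ) (hi : ∀ n : ℕ, Integrable (fun x => θ x ^ n) μ) (h0 : ∫ x, θ x ∂μ = 0)
    (q : ℕ) (hq : 1 ≤ q) :
    Integrable (fun p : X × X => (θ p.1 ^ (4 * q - 1) - θ p.2 ^ (4 * q - 1)) * (θ p.1 - θ p.2)
      - (1 / (4 * q : ℝ)) * (θ p.1 ^ (2 * q) - θ p.2 ^ (2 * q)) ^ 2) (μ.prod μ) ∧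
    μ.real Set.univ * ∫ x, θ x ^ (4 * q) ∂μ ≤
      ∫ p : X × X, ((θ p.1 ^ (4 * q - 1) - θ p.2 ^ (4 * q - 1)) * (θ p.1 - θ p.2)
      - (1 / (4 * q : ℝ)) * (θ p.1 ^ (2 * q) - θ p.2 ^ (2 * q)) ^ 2) ∂(μ.prod μ) := by
  have hq' : (1 : ℝ) ≤ q := by exact_mod_cast hq
  have I : ∀ m n : ℕ, Integrable (fun p : X × X => θ p.1 ^ m * θ p.2 ^ n) (μ.prod μ) :=
    fun m n => (hi m).mul_prod (hi n)
  have V : ∀ m n : ℕ, ∫ p : X × X, θ p.1 ^ m * θ p.2 ^ n ∂(μ.prod μ) =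
      (∫ x, θ x ^ m ∂μ) * ∫ x, θ x ^ n ∂μ :=
    fun m n => integral_prod_mul (fun x => θ x ^ m) (fun x => θ x ^ n)
  set r : ℝ := 1 / (4 * q : ℝ) with hr
  have hr1 : r ≤ 1 / 4 := by
    rw [hr]; exact one_div_le_one_div_of_le (by norm_num) (by linarith)
  have hr0 : 0 ≤ r := by positivity
  have e4 : 4 * q = (4 * q - 1) + 1 := by omega
  have efun : (fun p : X × X => (θ p.1 ^ (4 * q - 1) - θ p.2 ^ (4 * q - 1)) * (θ p.1 - θ p.2)
      - r * (θ p.1 ^ (2 * q) - θ p.2 ^ (2 * q)) ^ 2) = fun p : X × X =>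
      ((1 - r) * (θ p.1 ^ (4 * q) * θ p.2 ^ 0) + (1 - r) * (θ p.1 ^ 0 * θ p.2 ^ (4 * q)))
      + (2 * r) * (θ p.1 ^ (2 * q) * θ p.2 ^ (2 * q))
      - (θ p.1 ^ (4 * q - 1) * θ p.2 ^ 1 + θ p.1 ^ 1 * θ p.2 ^ (4 * q - 1)) := by
    funext p
    have x1 : ∀ a : ℝ, a ^ (4 * q) = a ^ (4 * q - 1) * a := fun a => by
      rw [← pow_succ]; congr 1
    have x2 : ∀ a : ℝ, a ^ (4 * q - 1) * a = a ^ (2 * q) * a ^ (2 * q) := fun a => by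
      rw [← pow_succ, ← pow_add]; congr 1; omega
    rw [x1, x1]
    linear_combination r * (x2 (θ p.1)) + r * (x2 (θ p.2))
  rw [efun]
  have J1 := ((I (4 * q) 0).const_mul (1 - r)).add ((I 0 (4 * q)).const_mul (1 - r))
  have J2 := (I (2 * q) (2 * q)).const_mul (2 * r)
  have J3 := (I (4 * q - 1) 1).add (I 1 (4 * q - 1))
  refine ⟨(J1.add J2).sub J3, ?_⟩
  have key := integral_sub (J1.add J2) J3
  simp only [Pi.add_apply] at key
  rw [key]
  have k1 := integral_add J1 J2
  simp only [Pi.add_apply] at k1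
  rw [k1, integral_add (I (4 * q - 1) 1) (I 1 (4 * q - 1)),
    integral_add ((I (4 * q) 0).const_mul (1 - r)) ((I 0 (4 * q)).const_mul (1 - r)),
    integral_const_mul, integral_const_mul, integral_const_mul, V, V, V, V, V]
  simp only [pow_one, pow_zero, h0, integral_const, smul_eq_mul, mul_one, mul_zero, zero_mul]
  have hA : 0 ≤ ∫ x, θ x ^ (4 * q) ∂μ := integral_nonneg fun x =>
    Even.pow_nonneg ⟨2 * q, by ring⟩ _
  have hV : 0 ≤ μ.real Set.univ := measureReal_nonneg
  have hB : 0 ≤ (∫ x, θ x ^ (2 * q) ∂μ) * ∫ x, θ x ^ (2 * q) ∂μ := mul_self_nonneg _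
  have hVA := mul_nonneg hV hA
  nlinarith [mul_nonneg hr0 hB, mul_nonneg (show 0 ≤ 1 / 4 - r by linarith) hVA]

/-- **`L^p` Poincaré inequality for the fractional Laplacian, kernel form.**
There is a constant `C_{α,d} ≥ 1`, independent of `p = 4q` and of `θ`, such that for every
smooth `2πℤ^d`-periodic zero-mean `θ`,
`(1/2) ∬ (θ(x)^{p−1} − θ(y)^{p−1})(θ(x) − θ(y)) K_α(x−y)
  ≥ (1/(2p)) ∬ (θ(x)^{p/2} − θ(y)^{p/2})² K_α(x−y) + (1/C) ∫ |θ|^p`. -/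
theorem fracLap_Lp_poincare (d : ℕ) (hd : 1 ≤ d) (α : ℝ) (hα : α ∈ Set.Ioo (0 : ℝ) 2) :
    ∃ C : ℝ, 1 ≤ C ∧
      ∀ q : ℕ, 1 ≤ q →
      ∀ θ : EuclideanSpace ℝ (Fin d) → ℝ, ContDiff ℝ (⊤ : ℕ∞) θ →
      (∀ (x : EuclideanSpace ℝ (Fin d)) (k : Fin d → ℤ),
        θ (x + (EuclideanSpace.equiv (Fin d) ℝ).symm (fun i => 2 * π * (k i : ℝ))) = θ x) →
      (∫ x in periodCell d, θ x) = 0 →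
      (1 / 2) * (∫ x in periodCell d, (∫ y in periodCell d,
          (θ x ^ (4 * q - 1) - θ y ^ (4 * q - 1)) * (θ x - θ y) * periodicKernelD d α (x - y))) ≥
        (1 / (2 * (4 * q : ℝ))) * (∫ x in periodCell d, (∫ y in periodCell d,
            (θ x ^ (2 * q) - θ y ^ (2 * q)) ^ 2 * periodicKernelD d α (x - y))) +
          (1 / C) * (∫ x in periodCell d, |θ x| ^ (4 * q)) := by
  obtain ⟨R, hR⟩ := (isCompact_periodCell d).isBounded.subset_closedBall 0
  set R' : ℝ := 2 * max R 1 with hR'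
  have hR'0 : 0 < R' := by have := le_max_right R 1; rw [hR']; linarith
  set κ : ℝ := fracLapConstD d α * R' ^ (-((d : ℝ) + α)) with hκ
  have hκ0 : 0 < κ := mul_pos (fracLapConstD_pos d α hα) (Real.rpow_pos_of_pos hR'0 _)
  set μ : Measure (EuclideanSpace ℝ (Fin d)) := volume.restrict (periodCell d) with hμ
  have hm : MeasurableSet (periodCell d) := (isCompact_periodCell d).measurableSet
  have hVfin : volume (periodCell d) < ⊤ := (isCompact_periodCell d).measure_lt_top
  have hfinμ : IsFiniteMeasure μ := ⟨by rw [hμ, Measure.restrict_apply_univ]; exact hVfin⟩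
  set V : ℝ := μ.real Set.univ with hV
  have hV0 : 0 < V := by
    rw [hV, hμ, measureReal_def, Measure.restrict_apply_univ, volume_periodCell]
    have : 0 < 2 * π := by positivity
    rw [ENNReal.toReal_pow, ENNReal.toReal_ofReal this.le]
    positivity
  refine ⟨max 1 (2 / (κ * V)), le_max_left _ _, ?_⟩
  intro q hq θ hθ hper hmean
  have hq' : (1 : ℝ) ≤ q := by exact_mod_cast hq
  obtain ⟨M, C, hM0, hC0, hM, hC⟩ := theta_bound d θ hθ hper
  have hcont : Continuous θ := hθ.continuous
  -- integrability of the two double integrands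
  have hF1 := integrable_mul_kernel d hd α hα
    (fun p => (θ p.1 ^ (4 * q - 1) - θ p.2 ^ (4 * q - 1)) * (θ p.1 - θ p.2))
    (by have := hcont.measurable; fun_prop)
    (((4 * q - 1 : ℕ) : ℝ) * M ^ (4 * q - 1 - 1) * C) (by positivity) (by
      intro x hx y hy k
      have h1 := abs_pow_sub_pow_le (θ x) (θ y) (4 * q - 1)
      have h2 : max |θ x| |θ y| ^ (4 * q - 1 - 1) ≤ M ^ (4 * q - 1 - 1) :=
        pow_le_pow_left₀ (by positivity) (max_le (hM x hx) (hM y hy)) _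
      have h3 := hC x hx y hy k
      rw [abs_mul]
      calc |θ x ^ (4 * q - 1) - θ y ^ (4 * q - 1)| * |θ x - θ y|
          ≤ (|θ x - θ y| * ((4 * q - 1 : ℕ) : ℝ) * M ^ (4 * q - 1 - 1)) * |θ x - θ y| := by
            refine mul_le_mul_of_nonneg_right (h1.trans ?_) (abs_nonneg _)
            exact mul_le_mul_of_nonneg_left h2 (by positivity)
        _ = ((4 * q - 1 : ℕ) : ℝ) * M ^ (4 * q - 1 - 1) * (θ x - θ y) ^ 2 := by
            rw [← sq_abs (θ x - θ y)]; ring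
        _ ≤ ((4 * q - 1 : ℕ) : ℝ) * M ^ (4 * q - 1 - 1) *
              (C * min 1 (‖x - y - latVec d k‖ ^ 2)) :=
            mul_le_mul_of_nonneg_left h3 (by positivity)
        _ = _ := by ring)
  have hF2 := integrable_mul_kernel d hd α hα
    (fun p => (θ p.1 ^ (2 * q) - θ p.2 ^ (2 * q)) ^ 2)
    (by have := hcont.measurable; fun_prop)
    ((((2 * q : ℕ) : ℝ) * M ^ (2 * q - 1)) ^ 2 * C) (by positivity) (by
      intro x hx y hy k
      have h1 := abs_pow_sub_pow_le (θ x) (θ y) (2 * q)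
      have h2 : max |θ x| |θ y| ^ (2 * q - 1) ≤ M ^ (2 * q - 1) :=
        pow_le_pow_left₀ (by positivity) (max_le (hM x hx) (hM y hy)) _
      have h3 := hC x hx y hy k
      have h4 : |θ x ^ (2 * q) - θ y ^ (2 * q)| ≤
          |θ x - θ y| * ((2 * q : ℕ) : ℝ) * M ^ (2 * q - 1) :=
        h1.trans (mul_le_mul_of_nonneg_left h2 (by positivity))
      rw [abs_of_nonneg (sq_nonneg _), ← sq_abs]
      calc |θ x ^ (2 * q) - θ y ^ (2 * q)| ^ 2
          ≤ (|θ x - θ y| * ((2 * q : ℕ) : ℝ) * M ^ (2 * q - 1)) ^ 2 :=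
            pow_le_pow_left₀ (abs_nonneg _) h4 2
        _ = (((2 * q : ℕ) : ℝ) * M ^ (2 * q - 1)) ^ 2 * (θ x - θ y) ^ 2 := by
            rw [← sq_abs (θ x - θ y)]; ring
        _ ≤ (((2 * q : ℕ) : ℝ) * M ^ (2 * q - 1)) ^ 2 *
              (C * min 1 (‖x - y - latVec d k‖ ^ 2)) :=
            mul_le_mul_of_nonneg_left h3 (by positivity)
        _ = _ := by ring)
  have hi : ∀ n : ℕ, Integrable (fun x => θ x ^ n) μ := fun n =>
    (hcont.pow n).continuousOn.integrableOn_compact (isCompact_periodCell d)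
  obtain ⟨hD, hDle⟩ := double_integral_lower μ θ hi hmean q hq
  have hmono : ∫ p, κ * ((θ p.1 ^ (4 * q - 1) - θ p.2 ^ (4 * q - 1)) * (θ p.1 - θ p.2)
        - (1 / (4 * q : ℝ)) * (θ p.1 ^ (2 * q) - θ p.2 ^ (2 * q)) ^ 2) ∂(μ.prod μ) ≤
      ∫ p, ((θ p.1 ^ (4 * q - 1) - θ p.2 ^ (4 * q - 1)) * (θ p.1 - θ p.2) *
          periodicKernelD d α (p.1 - p.2)
        - (1 / (4 * q : ℝ)) * ((θ p.1 ^ (2 * q) - θ p.2 ^ (2 * q)) ^ 2 *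
          periodicKernelD d α (p.1 - p.2))) ∂(μ.prod μ) := by
    refine integral_mono_ae (hD.const_mul κ) (hF1.sub (hF2.const_mul _)) ?_
    have hae : ∀ᵐ p ∂(μ.prod μ), p ∈ periodCell d ×ˢ periodCell d := by
      rw [hμ, Measure.prod_restrict]
      exact ae_restrict_mem (hm.prod hm)
    filter_upwards [hae] with p hp
    have hx : ‖p.1‖ ≤ R := by simpa using hR hp.1
    have hy : ‖p.2‖ ≤ R := by simpa using hR hp.2
    by_cases hz : p.1 = p.2
    · simp [hz]
    · have hK := kernel_lower d α hα (p.1 - p.2) (sub_ne_zero.2 hz) R' (by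
        have := norm_sub_le p.1 p.2
        have := le_max_left R 1
        rw [hR']; linarith)
      have hp := pointwise_ineq q hq (θ p.1) (θ p.2)
      have hnn : 0 ≤ (θ p.1 ^ (4 * q - 1) - θ p.2 ^ (4 * q - 1)) * (θ p.1 - θ p.2)
          - (1 / (4 * q : ℝ)) * (θ p.1 ^ (2 * q) - θ p.2 ^ (2 * q)) ^ 2 := by
        rw [sub_nonneg, one_div, inv_mul_le_iff₀ (by positivity)]
        exact hp
      refine (mul_le_mul_of_nonneg_right hK hnn).trans (le_of_eq ?_)
      ring
  rw [integral_const_mul, integral_sub hF1 (hF2.const_mul _), integral_const_mul,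
    integral_prod _ hF1, integral_prod _ hF2] at hmono
  have habs : ∫ x, |θ x| ^ (4 * q) ∂μ = ∫ x, θ x ^ (4 * q) ∂μ := by
    congr 1; funext x
    exact Even.pow_abs ⟨2 * q, by ring⟩ _
  rw [habs]
  have hA : 0 ≤ ∫ x, θ x ^ (4 * q) ∂μ := integral_nonneg fun x =>
    Even.pow_nonneg ⟨2 * q, by ring⟩ _
  have hCc : 1 / max 1 (2 / (κ * V)) ≤ κ * V / 2 := by
    have h1 : 2 / (κ * V) ≤ max 1 (2 / (κ * V)) := le_max_right _ _
    have h2 : 0 < 2 / (κ * V) := by positivity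
    have h3 := one_div_le_one_div_of_le h2 h1
    rwa [one_div_div] at h3
  have h5 := mul_le_mul_of_nonneg_right hCc hA
  have h6 := mul_le_mul_of_nonneg_left hDle hκ0.le
  have h7 : (1 / (2 * (4 * q : ℝ))) = (1 / 2) * (1 / (4 * q : ℝ)) := by
    rw [one_div_mul_one_div]
  rw [h7]
  linarith
end

section
/- There exists a universal constant C ≥ 1 with the following property. Let θ : ℝ² → ℝ be bounded and Lipschitz continuous, let x ∈ ℝ², let h ∈ ℝ² with h ≠ 0, and let r ≥ 4|h|. Writing δ_hθ(z) = θ(z+h) − θ(z) and D[δ_hθ](x) = (1/(2π)) ∫_{ℝ²} (δ_hθ(x) − δ_hθ(x+y))² |y|^{−3} dy, one has D[δ_hθ](x) ≥ (1/(2r)) |δ_hθ(x)|² − C ‖θ‖_{L^∞(ℝ²)} |δ_hθ(x)| |h| / r². -/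
open Real MeasureTheory

lemma aux_inv_tendsto (r : ℝ) :
    Filter.Tendsto (fun s : ℝ => (r + s)⁻¹) Filter.atTop (nhds 0) :=
  tendsto_inv_atTop_zero.comp (Filter.tendsto_atTop_add_const_left _ r Filter.tendsto_id)

lemma aux_hasDeriv3 (r : ℝ) (hr : 0 < r) (s : ℝ) (hs : 0 ≤ s) :
    HasDerivAt (fun s : ℝ => -(r + s)⁻¹ + r / 2 * ((r + s)⁻¹ * (r + s)⁻¹))
      (s * (1 / (r + s) ^ 3)) s := by
  have h0 : r + s ≠ 0 := by positivity
  have h1 : HasDerivAt (fun s : ℝ => (r + s)⁻¹) (-1 / (r + s) ^ 2) s :=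
    ((hasDerivAt_id s).const_add r).fun_inv h0
  refine (h1.fun_neg.fun_add ((h1.fun_mul h1).const_mul (r / 2))).congr_deriv ?_
  field_simp
  ring

lemma aux_lim3 (r : ℝ) :
    Filter.Tendsto (fun s : ℝ => -(r + s)⁻¹ + r / 2 * ((r + s)⁻¹ * (r + s)⁻¹))
      Filter.atTop (nhds 0) := by
  have h := aux_inv_tendsto r
  simpa using h.neg.add ((h.mul h).const_mul (r / 2))

lemma aux_w_integrable (r : ℝ) (hr : 0 < r) :
    Integrable (fun y : EuclideanSpace ℝ (Fin 2) => 1 / (r + ‖y‖) ^ 3) := by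
  have := (integrable_fun_norm_addHaar (volume : Measure (EuclideanSpace ℝ (Fin 2)))
    (f := fun s : ℝ => 1 / (r + s) ^ 3)).2
  apply this
  have h := integrableOn_Ioi_deriv_of_nonneg' (fun s (hs : s ∈ Set.Ici (0 : ℝ)) =>
    aux_hasDeriv3 r hr s hs)
    (fun s hs => by have : (0 : ℝ) < s := hs; positivity) (aux_lim3 r)
  simpa using h

lemma aux_w_integral (r : ℝ) (hr : 0 < r) :
    ∫ y : EuclideanSpace ℝ (Fin 2), 1 / (r + ‖y‖) ^ 3 = π / r := by
  have := integral_fun_norm_addHaar (volume : Measure (EuclideanSpace ℝ (Fin 2))) (fun s : ℝ => 1 / (r + s) ^ 3)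
  rw [this]
  have h := integral_Ioi_of_hasDerivAt_of_nonneg' (fun s (hs : s ∈ Set.Ici (0 : ℝ)) =>
    aux_hasDeriv3 r hr s hs)
    (fun s hs => by have : (0 : ℝ) < s := hs; positivity) (aux_lim3 r)
  have hv : (volume : Measure (EuclideanSpace ℝ (Fin 2))).real (Metric.ball 0 1) = π := by
    simp [Measure.real, EuclideanSpace.volume_ball_fin_two, pi_pos.le]
  simp only [finrank_euclideanSpace, Fintype.card_fin, hv, smul_eq_mul, nsmul_eq_mul,
    Nat.add_one_sub_one, pow_one] at *
  rw [h]
  push_cast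
  field_simp
  ring

lemma aux_dom_integrable :
    Integrable (fun y : EuclideanSpace ℝ (Fin 2) => 1 / (‖y‖ * (1 + ‖y‖) ^ 2)) := by
  have := (integrable_fun_norm_addHaar (volume : Measure (EuclideanSpace ℝ (Fin 2)))
    (f := fun s : ℝ => 1 / (s * (1 + s) ^ 2))).2
  apply this
  have hd : ∀ s ∈ Set.Ici (0 : ℝ), HasDerivAt (fun s : ℝ => -(1 + s)⁻¹) (1 / (1 + s) ^ 2) s := by
    intro s hs
    have hs : (0 : ℝ) ≤ s := hs
    have h0 : 1 + s ≠ 0 := by positivity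
    have h1 : HasDerivAt (fun s : ℝ => (1 + s)⁻¹) (-1 / (1 + s) ^ 2) s :=
      ((hasDerivAt_id s).const_add 1).fun_inv h0
    refine h1.fun_neg.congr_deriv ?_
    ring
  have h := integrableOn_Ioi_deriv_of_nonneg' hd
    (fun s hs => by positivity) (aux_inv_tendsto 1).neg
  refine h.congr_fun ?_ measurableSet_Ioi
  intro s hs
  have : (0 : ℝ) < s := hs
  simp
  field_simp

lemma aux_kernel (r : ℝ) (y h : EuclideanSpace ℝ (Fin 2)) (hh : h ≠ 0) (hr : 4 * ‖h‖ ≤ r) :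
    |1 / (r + ‖y - h‖) ^ 3 - 1 / (r + ‖y‖) ^ 3| ≤ 6 * ‖h‖ / r * (1 / (r + ‖y‖) ^ 3) := by
  have hp : 0 < ‖h‖ := norm_pos_iff.2 hh
  have hr0 : 0 < r := by linarith
  have hy := norm_nonneg y
  have hyh := norm_nonneg (y - h)
  have h1 : |‖y‖ - ‖y - h‖| ≤ ‖h‖ := by
    have := abs_norm_sub_norm_le y (y - h)
    simpa using this
  set A := r + ‖y‖ with hA
  set B := r + ‖y - h‖ with hB
  have hAB : |A - B| ≤ ‖h‖ := by
    have : A - B = ‖y‖ - ‖y - h‖ := by simp [hA, hB]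
    rwa [this]
  have hA0 : r ≤ A := by linarith
  have hB0 : 0 < B := by linarith
  have hAp : 0 < A := by linarith
  have hBA : 3 / 4 * A ≤ B := by
    have := (abs_le.1 hAB).2
    linarith
  have e : 1 / B ^ 3 - 1 / A ^ 3 = (A - B) * ((A ^ 2 + A * B + B ^ 2) / (A ^ 3 * B ^ 3)) := by
    field_simp
    ring
  rw [e, abs_mul, abs_of_pos (a := (A ^ 2 + A * B + B ^ 2) / (A ^ 3 * B ^ 3)) (by positivity)]
  have k : (A ^ 2 + A * B + B ^ 2) / (A ^ 3 * B ^ 3) ≤ 6 / r * (1 / A ^ 3) := by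
    rw [div_mul_div_comm, div_le_div_iff₀ (by positivity) (by positivity)]
    have k1 : A * (A ^ 2 + A * B + B ^ 2) ≤ 6 * B ^ 3 := by
      obtain ⟨t, ht⟩ : ∃ t, B = 3 / 4 * A + t := ⟨B - 3 / 4 * A, by ring⟩
      have ht0 : 0 ≤ t := by linarith
      rw [ht]
      have : 0 ≤ A ^ 3 := by positivity
      have : 0 ≤ A ^ 2 * t := by positivity
      have : 0 ≤ A * t ^ 2 := by positivity
      have : 0 ≤ t ^ 3 := by positivity
      nlinarith
    have k2 : r * (A ^ 2 + A * B + B ^ 2) ≤ 6 * B ^ 3 :=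
      le_trans (mul_le_mul_of_nonneg_right hA0 (by positivity)) k1
    calc _ = (r * (A ^ 2 + A * B + B ^ 2)) * A ^ 3 := by ring
      _ ≤ (6 * B ^ 3) * A ^ 3 := mul_le_mul_of_nonneg_right k2 (by positivity)
      _ = _ := by ring
  calc _ ≤ ‖h‖ * (6 / r * (1 / A ^ 3)) := by gcongr
    _ = _ := by ring

lemma aux_main_integrable (θ : EuclideanSpace ℝ (Fin 2) → ℝ) (M : ℝ) (hM : ∀ z, |θ z| ≤ M) (K : NNReal)
    (hK : LipschitzWith K θ) (x h : EuclideanSpace ℝ (Fin 2)) :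
    Integrable (fun y : EuclideanSpace ℝ (Fin 2) =>
          ((θ (x + h) - θ x) - (θ (x + y + h) - θ (x + y))) ^ 2 / ‖y‖ ^ 3) := by
  have hc := hK.continuous
  refine Integrable.mono' (aux_dom_integrable.const_mul (4 * ((2 * K) ^ 2 + (4 * M) ^ 2)))
    (Measurable.aestronglyMeasurable ?_) (Filter.Eventually.of_forall fun y => ?_)
  · have : Continuous fun y : EuclideanSpace ℝ (Fin 2) => ((θ (x + h) - θ x) - (θ (x + y + h) - θ (x + y))) ^ 2 := by
      fun_prop
    exact this.measurable.div (by fun_prop)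
  · rw [Real.norm_of_nonneg (by positivity)]
    rcases eq_or_ne y 0 with rfl | hy
    · simp
    have hs : 0 < ‖y‖ := norm_pos_iff.2 hy
    set u := (θ (x + h) - θ x) - (θ (x + y + h) - θ (x + y)) with hu
    have b1 : |u| ≤ 4 * M := by
      have := hM (x + h); have := hM x; have := hM (x + y + h); have := hM (x + y)
      simp only [abs_le] at *
      constructor <;> linarith
    have b2 : |u| ≤ 2 * K * ‖y‖ := by
      have c1 := hK.dist_le_mul (x + h) (x + y + h)
      have c2 := hK.dist_le_mul (x) (x + y)
      rw [Real.dist_eq] at c1 c2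
      have d1 : dist (x + h) (x + y + h) = ‖y‖ := by
        rw [dist_eq_norm]; rw [← norm_neg]; congr 1; abel
      have d2 : dist x (x + y) = ‖y‖ := by simp
      rw [d1] at c1
      rw [d2] at c2
      simp only [abs_le] at *
      constructor <;> linarith
    have s1 : u ^ 2 ≤ (4 * M) ^ 2 := sq_le_sq' (abs_le.1 b1).1 (abs_le.1 b1).2
    have s2 : u ^ 2 ≤ (2 * K * ‖y‖) ^ 2 := sq_le_sq' (abs_le.1 b2).1 (abs_le.1 b2).2
    set s := ‖y‖
    rw [mul_one_div, div_le_div_iff₀ (by positivity) (by positivity)]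
    have key : u ^ 2 * (1 + s) ^ 2 ≤ 4 * ((2 * K) ^ 2 + (4 * M) ^ 2) * s ^ 2 := by
      rcases le_total s 1 with h1 | h1
      · have : (1 + s) ^ 2 ≤ 4 := by nlinarith
        calc u ^ 2 * (1 + s) ^ 2 ≤ (2 * K * s) ^ 2 * 4 := by gcongr
          _ ≤ _ := by nlinarith [sq_nonneg (4 * M * s)]
      · have : (1 + s) ^ 2 ≤ 4 * s ^ 2 := by nlinarith
        calc u ^ 2 * (1 + s) ^ 2 ≤ (4 * M) ^ 2 * (4 * s ^ 2) := by gcongr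
          _ ≤ _ := by nlinarith [sq_nonneg (2 * K * s)]
    calc _ = (u ^ 2 * (1 + s) ^ 2) * s := by ring
      _ ≤ (4 * ((2 * K) ^ 2 + (4 * M) ^ 2) * s ^ 2) * s := by gcongr
      _ = _ := by ring

lemma aux_shift_integral (θ : EuclideanSpace ℝ (Fin 2) → ℝ) (M : ℝ) (hM : ∀ z, |θ z| ≤ M)
    (hc : Continuous θ) (x h : EuclideanSpace ℝ (Fin 2)) (hh : h ≠ 0) (r : ℝ) (hr : 4 * ‖h‖ ≤ r) :
    Integrable (fun y : EuclideanSpace ℝ (Fin 2) => (θ (x + y + h) - θ (x + y)) * (1 / (r + ‖y‖) ^ 3)) ∧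
    |∫ y : EuclideanSpace ℝ (Fin 2), (θ (x + y + h) - θ (x + y)) * (1 / (r + ‖y‖) ^ 3)| ≤ 6 * π * M * ‖h‖ / r ^ 2 := by
  have hp : 0 < ‖h‖ := norm_pos_iff.2 hh
  have hr0 : 0 < r := by linarith
  have hw := aux_w_integrable r hr0
  have hM0 : 0 ≤ M := (abs_nonneg _).trans (hM 0)
  have i1 : Integrable (fun y : EuclideanSpace ℝ (Fin 2) => θ (x + y + h) * (1 / (r + ‖y‖) ^ 3)) :=
    hw.bdd_mul (c := M) (by fun_prop) (Filter.Eventually.of_forall fun y => hM _)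
  have i2 : Integrable (fun y : EuclideanSpace ℝ (Fin 2) => θ (x + y) * (1 / (r + ‖y‖) ^ 3)) :=
    hw.bdd_mul (c := M) (by fun_prop) (Filter.Eventually.of_forall fun y => hM _)
  have i3 : Integrable (fun y : EuclideanSpace ℝ (Fin 2) => θ (x + y) * (1 / (r + ‖y - h‖) ^ 3)) :=
    (hw.comp_sub_right h).bdd_mul (c := M) (by fun_prop) (Filter.Eventually.of_forall fun y => hM _)
  have e1 : ∫ y : EuclideanSpace ℝ (Fin 2), θ (x + y + h) * (1 / (r + ‖y‖) ^ 3)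
      = ∫ y : EuclideanSpace ℝ (Fin 2), θ (x + y) * (1 / (r + ‖y - h‖) ^ 3) := by
    rw [← integral_add_right_eq_self (fun y : EuclideanSpace ℝ (Fin 2) => θ (x + y) * (1 / (r + ‖y - h‖) ^ 3)) h]
    simp [add_assoc]
  refine ⟨by simp only [sub_mul]; exact i1.sub i2, ?_⟩
  simp only [sub_mul]
  rw [integral_sub i1 i2, e1, ← integral_sub i3 i2, ← Real.norm_eq_abs]
  calc _ ≤ ∫ y : EuclideanSpace ℝ (Fin 2), M * (6 * ‖h‖ / r * (1 / (r + ‖y‖) ^ 3)) := by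
        refine norm_integral_le_of_norm_le ((hw.const_mul _).const_mul _)
          (Filter.Eventually.of_forall fun y => ?_)
        rw [← mul_sub, norm_mul]
        exact mul_le_mul (hM _) (aux_kernel r y h hh hr) (norm_nonneg _) hM0
    _ = _ := by
        rw [integral_const_mul, integral_const_mul, aux_w_integral r hr0]
        field_simp

/-- **intermediate lower bound on the dissipation, 2D.**
There is a universal constant `C ≥ 1` such that for every bounded Lipschitz `θ : ℝ² → ℝ`,
every `x`, every `h ≠ 0`, and every truncation radius `r ≥ 4|h|`, the dissipation
`D[δ_hθ](x) = (1/(2π)) ∫ (δ_hθ(x) − δ_hθ(x+y))² |y|^{−3} dy` satisfies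
`D[δ_hθ](x) ≥ (1/(2r)) |δ_hθ(x)|² − C ‖θ‖_{L^∞} |δ_hθ(x)| |h| / r²`. -/
theorem dissipation_truncated_lower_bound :
    ∃ C : ℝ, 1 ≤ C ∧
      ∀ θ : EuclideanSpace ℝ (Fin 2) → ℝ,
      (∃ M : ℝ, ∀ z, |θ z| ≤ M) → (∃ K : NNReal, LipschitzWith K θ) →
      ∀ x h : EuclideanSpace ℝ (Fin 2), h ≠ 0 →
      ∀ r : ℝ, 4 * ‖h‖ ≤ r →
        Integrable (fun y : EuclideanSpace ℝ (Fin 2) =>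
          ((θ (x + h) - θ x) - (θ (x + y + h) - θ (x + y))) ^ 2 / ‖y‖ ^ 3) ∧
        (1 / (2 * π)) * (∫ y : EuclideanSpace ℝ (Fin 2),
            ((θ (x + h) - θ x) - (θ (x + y + h) - θ (x + y))) ^ 2 / ‖y‖ ^ 3) ≥
          (1 / (2 * r)) * |θ (x + h) - θ x| ^ 2 -
            C * (⨆ z, |θ z|) * |θ (x + h) - θ x| * ‖h‖ / r ^ 2 := by
  refine ⟨6, by norm_num, ?_⟩
  rintro θ ⟨M', hM'⟩ ⟨K, hK⟩ x h hh r hr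
  have hint := aux_main_integrable θ M' hM' K hK x h
  refine ⟨hint, ?_⟩
  have hM : ∀ z, |θ z| ≤ ⨆ z, |θ z| :=
    fun z => le_ciSup (f := fun z => |θ z|) ⟨M', by rintro _ ⟨z, rfl⟩; exact hM' z⟩ z
  set M := ⨆ z, |θ z|
  have hp : 0 < ‖h‖ := norm_pos_iff.2 hh
  have hr0 : 0 < r := by linarith
  have hw := aux_w_integrable r hr0
  obtain ⟨j1, j2⟩ := aux_shift_integral θ M hM hK.continuous x h hh r hr
  set a := θ (x + h) - θ x with ha
  have lower : a ^ 2 * (π / r) -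
      2 * a * ∫ y : EuclideanSpace ℝ (Fin 2), (θ (x + y + h) - θ (x + y)) * (1 / (r + ‖y‖) ^ 3)
      ≤ ∫ y : EuclideanSpace ℝ (Fin 2), (a - (θ (x + y + h) - θ (x + y))) ^ 2 / ‖y‖ ^ 3 := by
    rw [← aux_w_integral r hr0, ← integral_const_mul, ← integral_const_mul,
      ← integral_sub (hw.const_mul _) (j1.const_mul _)]
    refine integral_mono_ae ((hw.const_mul _).sub (j1.const_mul _)) hint ?_
    filter_upwards [Measure.ae_ne volume (0 : EuclideanSpace ℝ (Fin 2))] with y hy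
    have hs : 0 < ‖y‖ := norm_pos_iff.2 hy
    set b := θ (x + y + h) - θ (x + y)
    have hle : 1 / (r + ‖y‖) ^ 3 ≤ 1 / ‖y‖ ^ 3 := by gcongr; linarith
    have hw0 : 0 ≤ 1 / (r + ‖y‖) ^ 3 := by positivity
    calc a ^ 2 * (1 / (r + ‖y‖) ^ 3) - 2 * a * (b * (1 / (r + ‖y‖) ^ 3))
        ≤ (a - b) ^ 2 * (1 / (r + ‖y‖) ^ 3) := by nlinarith [mul_nonneg (sq_nonneg b) hw0]
      _ ≤ (a - b) ^ 2 * (1 / ‖y‖ ^ 3) := by gcongr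
      _ = _ := by ring
  set I := ∫ y : EuclideanSpace ℝ (Fin 2), (θ (x + y + h) - θ (x + y)) * (1 / (r + ‖y‖) ^ 3)
  have hI : a * I ≤ |a| * (6 * π * M * ‖h‖ / r ^ 2) :=
    (le_abs_self _).trans (by rw [abs_mul]; gcongr)
  have hpi := pi_pos
  calc (1 / (2 * π)) * ∫ y : EuclideanSpace ℝ (Fin 2), (a - (θ (x + y + h) - θ (x + y))) ^ 2 / ‖y‖ ^ 3
      ≥ (1 / (2 * π)) * (a ^ 2 * (π / r) - 2 * (|a| * (6 * π * M * ‖h‖ / r ^ 2))) := by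
        apply mul_le_mul_of_nonneg_left _ (by positivity)
        linarith
    _ = _ := by
        rw [sq_abs]
        field_simp
end
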